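/- Every heptagon has at least one non-crossing standardization line: if p_0, …, p_6 ∈ ℝ² are in clockwise convex position, then there exists i ∈ ℤ/7ℤ such that the seven numbers ⟨ℓ_i, p̂_j⟩, j ∈ ℤ/7ℤ, are all nonzero and of the same sign. -/

import Mathlib

open Matrix

/-- Homogeneous coordinates of a point in the plane. -/
noncomputable def hat (p : Fin 2 → ℝ) : Fin 3 → ℝ := ![p 0, p 1, 1]

/-- Determinant of the 3×3 matrix with rows `u`, `v`, `w`. -/
def det3 (u v w : Fin 3 → ℝ) : ℝ := Matrix.det (Matrix.of ![u, v, w])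

/-- The standardization point `p_i⁺`. -/
noncomputable def pplus (p : Fin 7 → Fin 2 → ℝ) (i : Fin 7) : Fin 3 → ℝ :=
  crossProduct (crossProduct (hat (p (i + 1))) (hat (p (i + 2))))
    (crossProduct (hat (p i)) (hat (p (i + 3))))

/-- The standardization point `p_i⁻`. -/
noncomputable def pminus (p : Fin 7 → Fin 2 → ℝ) (i : Fin 7) : Fin 3 → ℝ :=
  crossProduct (crossProduct (hat (p (i - 1))) (hat (p (i - 2))))
    (crossProduct (hat (p i)) (hat (p (i - 3))))

/-- The `i`-th standardization line `ℓ_i` (in homogeneous line coordinates). -/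
noncomputable def sline (p : Fin 7 → Fin 2 → ℝ) (i : Fin 7) : Fin 3 → ℝ :=
  crossProduct (pplus p i) (pminus p i)

/-- The signed area form on three vertices of a heptagon. -/
noncomputable def tri (p : Fin 7 → Fin 2 → ℝ) (i j k : Fin 7) : ℝ :=
  det3 (hat (p i)) (hat (p j)) (hat (p k))

/-- The vertices of a heptagon, in order, are in clockwise convex position. -/
def ClockwiseConvex (p : Fin 7 → Fin 2 → ℝ) : Prop :=
  ∀ i j k : Fin 7, i < j → j < k → tri p i j k < 0

/-- The heptagon with its vertices relabelled by a cyclic shift. -/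
def rotate (p : Fin 7 → Fin 2 → ℝ) (r : Fin 7) : Fin 7 → Fin 2 → ℝ := fun j => p (j + r)

/-- The line `ℓ_0` fails to have `p_1` and `p_2` strictly on the same side as `p_0`. -/
def CrossesRight (p : Fin 7 → Fin 2 → ℝ) : Prop :=
  tri p 0 5 6 * tri p 1 2 4 ≤ tri p 0 1 2 * tri p 4 5 6

/-- The line `ℓ_0` fails to have `p_5` and `p_6` strictly on the same side as `p_0`. -/
def CrossesLeft (p : Fin 7 → Fin 2 → ℝ) : Prop :=
  tri p 0 1 2 * tri p 3 5 6 ≤ tri p 0 5 6 * tri p 1 2 3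

lemma det3_hat (u v w : Fin 2 → ℝ) :
    det3 (hat u) (hat v) (hat w) =
      u 0 * v 1 - u 0 * w 1 - u 1 * v 0 + u 1 * w 0 + v 0 * w 1 - v 1 * w 0 := by
  simp [det3, hat, Matrix.det_fin_three]

lemma tri_cycle (p : Fin 7 → Fin 2 → ℝ) (i j k : Fin 7) : tri p i j k = tri p j k i := by
  simp only [tri, det3_hat]
  ring

lemma rotate_rotate (p : Fin 7 → Fin 2 → ℝ) (r s : Fin 7) :
    rotate (rotate p r) s = rotate p (s + r) := by
  funext j
  simp [rotate, add_assoc]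

lemma rotate_zero (p : Fin 7 → Fin 2 → ℝ) : rotate p 0 = p := by
  funext j
  simp [rotate]

lemma sline_rotate_dotProduct (p : Fin 7 → Fin 2 → ℝ) (r j : Fin 7) :
    sline (rotate p r) 0 ⬝ᵥ hat (rotate p r j) = sline p r ⬝ᵥ hat (p (j + r)) := by
  simp only [sline, pplus, pminus, rotate, zero_add, sub_eq_add_neg,
    add_comm _ r, add_zero]

lemma clockwiseConvex_rotate {p : Fin 7 → Fin 2 → ℝ} (hp : ClockwiseConvex p) (r : Fin 7) :
    ClockwiseConvex (rotate p r) := by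
  intro i j k hij hjk
  have hcyc : (i + r < j + r ∧ j + r < k + r) ∨ (j + r < k + r ∧ k + r < i + r) ∨
      (k + r < i + r ∧ i + r < j + r) := by
    simp only [Fin.lt_def, Fin.val_add] at *
    omega
  change tri p (i + r) (j + r) (k + r) < 0
  rcases hcyc with h | h | h
  · exact hp _ _ _ h.1 h.2
  · rw [tri_cycle]
    exact hp _ _ _ h.1 h.2
  · rw [tri_cycle, tri_cycle]
    exact hp _ _ _ h.1 h.2

lemma sline_dotProduct (p : Fin 7 → Fin 2 → ℝ) (j : Fin 7) :
    sline p 0 ⬝ᵥ hat (p j) =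
      tri p 1 2 3 * tri p 0 5 6 * tri p 0 4 j - tri p 0 1 2 * tri p 4 5 6 * tri p 0 3 j
        - tri p 0 1 2 * tri p 0 5 6 * tri p 3 4 j := by
  have h1 : (0 : Fin 7) - 1 = 6 := rfl
  have h2 : (0 : Fin 7) - 2 = 5 := rfl
  have h3 : (0 : Fin 7) - 3 = 4 := rfl
  simp only [sline, pplus, pminus, tri, det3_hat, h1, h2, h3, zero_add]
  simp [hat, crossProduct, dotProduct, Fin.sum_univ_three]
  ring

lemma ClockwiseConvex.sline_pos {p : Fin 7 → Fin 2 → ℝ} (hp : ClockwiseConvex p)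
    (hr : ¬ CrossesRight p) (hl : ¬ CrossesLeft p) (j : Fin 7) :
    0 < sline p 0 ⬝ᵥ hat (p j) := by
  have hr' : 0 < tri p 0 5 6 * tri p 1 2 4 - tri p 0 1 2 * tri p 4 5 6 := by
    simpa [CrossesRight] using hr
  have hl' : 0 < tri p 0 1 2 * tri p 3 5 6 - tri p 0 5 6 * tri p 1 2 3 := by
    simpa [CrossesLeft] using hl
  have h012 := hp 0 1 2 (by decide) (by decide)
  have h123 := hp 1 2 3 (by decide) (by decide)
  have h456 := hp 4 5 6 (by decide) (by decide)
  have h056 := hp 0 5 6 (by decide) (by decide)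
  have h034 := hp 0 3 4 (by decide) (by decide)
  rw [sline_dotProduct]
  match j with
  | 0 =>
    refine (mul_pos (mul_pos_of_neg_of_neg h012 h056) (neg_pos.2 h034)).trans_eq ?_
    simp only [tri, det3_hat]
    ring
  | 1 =>
    refine (mul_pos (neg_pos.2 (hp 0 1 3 (by decide) (by decide))) hr').trans_eq ?_
    simp only [tri, det3_hat]
    ring
  | 2 =>
    refine (mul_pos (neg_pos.2 (hp 0 2 3 (by decide) (by decide))) hr').trans_eq ?_
    simp only [tri, det3_hat]
    ring
  | 3 =>
    refine (mul_pos (mul_pos_of_neg_of_neg h123 h056) (neg_pos.2 h034)).trans_eq ?_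
    simp only [tri, det3_hat]
    ring
  | 4 =>
    refine (mul_pos (mul_pos_of_neg_of_neg h012 h456) (neg_pos.2 h034)).trans_eq ?_
    simp only [tri, det3_hat]
    ring
  | 5 =>
    refine (mul_pos (neg_pos.2 (hp 0 4 5 (by decide) (by decide))) hl').trans_eq ?_
    simp only [tri, det3_hat]
    ring
  | 6 =>
    refine (mul_pos (neg_pos.2 (hp 0 4 6 (by decide) (by decide))) hl').trans_eq ?_
    simp only [tri, det3_hat]
    ring

lemma ClockwiseConvex.not_crossesRight_rotate_three {p : Fin 7 → Fin 2 → ℝ}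
    (hp : ClockwiseConvex p) (hl : CrossesLeft p) : ¬ CrossesRight (rotate p 3) := by
  intro hr
  have hr' : tri p 1 2 3 * tri p 0 4 5 ≤ tri p 3 4 5 * tri p 0 1 2 := by
    rw [tri_cycle p 0 4 5, ← tri_cycle p 3 1 2]
    exact hr
  have h012 := hp 0 1 2 (by decide) (by decide)
  have h123 := hp 1 2 3 (by decide) (by decide)
  have h056 := hp 0 5 6 (by decide) (by decide)
  have h045 := hp 0 4 5 (by decide) (by decide)
  have hmul := mul_le_mul hl hr' (mul_pos_of_neg_of_neg h123 h045).le
    (mul_pos_of_neg_of_neg h056 h123).le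
  have hle : tri p 3 5 6 * tri p 0 4 5 ≤ tri p 0 5 6 * tri p 3 4 5 := by
    refine le_of_mul_le_mul_left ?_ (mul_pos_of_neg_of_neg h012 h123)
    linarith
  have hplu : tri p 3 5 6 * tri p 0 4 5 =
      tri p 0 5 6 * tri p 3 4 5 + tri p 0 3 5 * tri p 4 5 6 := by
    simp only [tri, det3_hat]
    ring
  have hpos := mul_pos_of_neg_of_neg (hp 0 3 5 (by decide) (by decide))
    (hp 4 5 6 (by decide) (by decide))
  linarith

lemma ClockwiseConvex.not_crossesRight_consecutive {p : Fin 7 → Fin 2 → ℝ}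
    (hp : ClockwiseConvex p) (h0 : CrossesRight p) (h1 : CrossesRight (rotate p 1)) :
    ¬ CrossesRight (rotate p 2) := by
  intro h2
  have h1' : tri p 0 1 6 * tri p 2 3 5 ≤ tri p 1 2 3 * tri p 0 5 6 := by
    rw [tri_cycle p 0 1 6, tri_cycle p 0 5 6]
    exact h1
  have h2' : tri p 0 1 2 * tri p 3 4 6 ≤ tri p 2 3 4 * tri p 0 1 6 := by
    rw [← tri_cycle p 2 0 1, ← tri_cycle p 6 0 1]
    exact h2
  have h012 := hp 0 1 2 (by decide) (by decide)
  have h016 := hp 0 1 6 (by decide) (by decide)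
  have h056 := hp 0 5 6 (by decide) (by decide)
  have h123 := hp 1 2 3 (by decide) (by decide)
  have h235 := hp 2 3 5 (by decide) (by decide)
  have h346 := hp 3 4 6 (by decide) (by decide)
  have h456 := hp 4 5 6 (by decide) (by decide)
  have hmul := mul_le_mul (mul_le_mul h0 h1' (mul_pos_of_neg_of_neg h016 h235).le
      (mul_pos_of_neg_of_neg h012 h456).le) h2' (mul_pos_of_neg_of_neg h012 h346).le
    (mul_pos (mul_pos_of_neg_of_neg h012 h456) (mul_pos_of_neg_of_neg h123 h056)).le
  have hle : tri p 1 2 3 * tri p 2 3 4 * tri p 4 5 6 ≤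
      tri p 1 2 4 * tri p 2 3 5 * tri p 3 4 6 := by
    rw [← mul_le_mul_left_of_neg
      (mul_neg_of_pos_of_neg (mul_pos_of_neg_of_neg h012 h016) h056)]
    linarith
  have hplu : tri p 1 2 4 * tri p 2 3 5 * tri p 3 4 6 =
      tri p 1 2 3 * tri p 2 3 4 * tri p 4 5 6 + tri p 1 2 3 * (tri p 2 4 6 * tri p 3 4 5) +
        tri p 3 4 6 * (tri p 1 2 5 * tri p 2 3 4) := by
    simp only [tri, det3_hat]
    ring
  have hneg := mul_neg_of_neg_of_pos h123 (mul_pos_of_neg_of_neg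
    (hp 2 4 6 (by decide) (by decide)) (hp 3 4 5 (by decide) (by decide)))
  have hneg' := mul_neg_of_neg_of_pos h346 (mul_pos_of_neg_of_neg
    (hp 1 2 5 (by decide) (by decide)) (hp 2 3 4 (by decide) (by decide)))
  linarith

lemma ClockwiseConvex.not_crossesLeft_consecutive {p : Fin 7 → Fin 2 → ℝ}
    (hp : ClockwiseConvex p) (h0 : CrossesLeft p) (h1 : CrossesLeft (rotate p 1)) :
    ¬ CrossesLeft (rotate p 2) := by
  intro h2
  have h1' : tri p 1 2 3 * tri p 0 4 6 ≤ tri p 0 1 6 * tri p 2 3 4 := by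
    rw [tri_cycle p 0 4 6, tri_cycle p 0 1 6]
    exact h1
  have h2' : tri p 2 3 4 * tri p 0 1 5 ≤ tri p 0 1 2 * tri p 3 4 5 := by
    rw [← tri_cycle p 5 0 1, ← tri_cycle p 2 0 1]
    exact h2
  have h012 := hp 0 1 2 (by decide) (by decide)
  have h015 := hp 0 1 5 (by decide) (by decide)
  have h016 := hp 0 1 6 (by decide) (by decide)
  have h046 := hp 0 4 6 (by decide) (by decide)
  have h056 := hp 0 5 6 (by decide) (by decide)
  have h123 := hp 1 2 3 (by decide) (by decide)
  have h234 := hp 2 3 4 (by decide) (by decide)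
  have hmul := mul_le_mul (mul_le_mul h0 h1' (mul_pos_of_neg_of_neg h123 h046).le
      (mul_pos_of_neg_of_neg h056 h123).le) h2' (mul_pos_of_neg_of_neg h234 h015).le
    (mul_pos (mul_pos_of_neg_of_neg h056 h123) (mul_pos_of_neg_of_neg h016 h234)).le
  have hle : tri p 0 5 6 * tri p 0 1 6 * tri p 3 4 5 ≤
      tri p 3 5 6 * tri p 0 4 6 * tri p 0 1 5 := by
    rw [← mul_le_mul_left_of_neg
      (mul_neg_of_pos_of_neg (mul_pos_of_neg_of_neg h012 h123) h234)]
    linarith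
  have hplu : tri p 3 5 6 * tri p 0 4 6 * tri p 0 1 5 =
      tri p 0 5 6 * tri p 0 1 6 * tri p 3 4 5 + tri p 0 1 6 * (tri p 0 3 5 * tri p 4 5 6) +
        tri p 0 5 6 * (tri p 0 1 4 * tri p 3 5 6) := by
    simp only [tri, det3_hat]
    ring
  have hneg := mul_neg_of_neg_of_pos h016 (mul_pos_of_neg_of_neg
    (hp 0 3 5 (by decide) (by decide)) (hp 4 5 6 (by decide) (by decide)))
  have hneg' := mul_neg_of_neg_of_pos h056 (mul_pos_of_neg_of_neg
    (hp 0 1 4 (by decide) (by decide)) (hp 3 5 6 (by decide) (by decide)))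
  linarith

/-- Every heptagon has at least one non-crossing standardization line. -/
theorem heptagon_has_noncrossing_standardization_line
    (p : Fin 7 → Fin 2 → ℝ)
    (hconv : ∀ i j k : Fin 7, i < j → j < k →
      det3 (hat (p i)) (hat (p j)) (hat (p k)) < 0) :
    ∃ i : Fin 7,
      (∀ j : Fin 7, 0 < sline p i ⬝ᵥ hat (p j)) ∨
      (∀ j : Fin 7, sline p i ⬝ᵥ hat (p j) < 0) := by
  have hp : ClockwiseConvex p := hconv
  by_contra! hcross
  have hor : ∀ i, CrossesRight (rotate p i) ∨ CrossesLeft (rotate p i) := by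
    intro i
    by_contra! h
    obtain ⟨j, hj⟩ := (hcross i).1
    have hpos := (clockwiseConvex_rotate hp i).sline_pos h.1 h.2 (j - i)
    rw [sline_rotate_dotProduct, sub_add_cancel] at hpos
    exact hj.not_gt hpos
  have hstep : ∀ i, CrossesLeft (rotate p i) → CrossesLeft (rotate p (3 + i)) := by
    intro i hi
    have h := (clockwiseConvex_rotate hp i).not_crossesRight_rotate_three hi
    rw [rotate_rotate] at h
    exact (hor _).resolve_left h
  by_cases hl : CrossesLeft p
  · have h3 : CrossesLeft (rotate p 3) := hstep 0 (by rwa [rotate_zero])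
    have h2 : CrossesLeft (rotate p 2) := hstep 6 (hstep 3 h3)
    have h1 : CrossesLeft (rotate p 1) := hstep 5 (hstep 2 h2)
    exact hp.not_crossesLeft_consecutive hl h1 h2
  · have h4 : ¬ CrossesLeft (rotate p 4) := fun h => hl (rotate_zero p ▸ hstep 4 h)
    have h1 : ¬ CrossesLeft (rotate p 1) := fun h => h4 (hstep 1 h)
    have h5 : ¬ CrossesLeft (rotate p 5) := fun h => h1 (hstep 5 h)
    have h2 : ¬ CrossesLeft (rotate p 2) := fun h => h5 (hstep 2 h)
    have hr : CrossesRight p := by simpa [rotate_zero, hl] using hor 0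
    exact hp.not_crossesRight_consecutive hr ((hor 1).resolve_right h1) ((hor 2).resolve_right h2)
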